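/- There exist δ > 0 and constants C_{a,b} > 0 (a, b ∈ ℕ) such that for every ξ ∈ (0,1] the following holds. There is a smooth complex-valued function τ(·,·) on {(x,ξ) : 0 < ξ ≤ 1, 0 ≤ x ≤ δ/ξ}, real-valued in the first variable, such that the functions φ₁(x,ξ) := (1+x²)(1 + ξ² τ(x,ξ)) and φ₂(x,ξ) := φ₁(x,ξ) ∫_x^{δ/ξ} φ₁(y,ξ)^{−2} dy are real-valued, both satisfy −φ''(x) + (2/(1+x²)) φ(x) = ξ² φ(x) for 0 ≤ x ≤ δ/ξ, their Wronskian satisfies ∂ₓφ₁(x,ξ)·φ₂(x,ξ) − φ₁(x,ξ)·∂ₓφ₂(x,ξ) = 1 for all 0 ≤ x ≤ δ/ξ, and for all a, b ∈ ℕ and 0 ≤ x ≤ δ/ξ one has |(⟨x⟩∂ₓ)^a (ξ∂_ξ)^b τ(x,ξ)| ≤ C_{a,b} ⟨x⟩² and |(⟨x⟩∂ₓ)^a (ξ∂_ξ)^b φ₂(x,ξ)| ≤ C_{a,b} ⟨x⟩^{−1}. -/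

import Mathlib

noncomputable section

open MeasureTheory Complex Filter

/-- Japanese bracket `⟨x⟩ = (1+x²)^{1/2}`. -/
def jap (x : ℝ) : ℝ := Real.sqrt (1 + x ^ 2)

/-- The operator `g ↦ ⟨x⟩ ∂ₓ g` acting in the first variable (real-valued functions). -/
def DXR (F : ℝ → ℝ → ℝ) : ℝ → ℝ → ℝ := fun x ξ => jap x * deriv (fun y => F y ξ) x

/-- The operator `g ↦ ξ ∂_ξ g` acting in the second variable (real-valued functions). -/
def DXIR (F : ℝ → ℝ → ℝ) : ℝ → ℝ → ℝ := fun x ξ => ξ * deriv (fun η => F x η) ξ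

open scoped Topology

section Symbols

/-- An open neighbourhood of `{0 < ξ ≤ 1, 0 ≤ x ≤ 1 / (4ξ)}`. -/
def symbolRegion : Set (ℝ × ℝ) :=
  {p | 0 < p.2 ∧ p.2 < 2 ∧ -(1 / 4) < p.1 ∧ p.1 * p.2 < 1 / 2}

/-- `F = O(⟨x⟩^m)` on `symbolRegion`. -/
def SymbolBound (m : ℤ) (F : ℝ → ℝ → ℝ) : Prop :=
  ∃ C, ∀ p ∈ symbolRegion, |F p.1 p.2| ≤ C * jap p.1 ^ m

/-- Symbols of order `m` on `symbolRegion`, up to `n` applications of `⟨x⟩∂ₓ` and `ξ∂_ξ`. -/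
def IsSymbol : ℕ → ℤ → (ℝ → ℝ → ℝ) → Prop
  | 0, m, F => SymbolBound m F
  | n + 1, m, F => SymbolBound m F ∧ ∃ G H : ℝ → ℝ → ℝ,
      (∀ p ∈ symbolRegion, HasDerivAt (fun y => F y p.2) ((jap p.1)⁻¹ * G p.1 p.2) p.1) ∧
      (∀ p ∈ symbolRegion, HasDerivAt (F p.1) (p.2⁻¹ * H p.1 p.2) p.2) ∧
      IsSymbol n m G ∧ IsSymbol n m H

lemma isOpen_symbolRegion : IsOpen symbolRegion := by
  have h₁ : IsOpen {p : ℝ × ℝ | 0 < p.2} := isOpen_lt continuous_const continuous_snd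
  have h₂ : IsOpen {p : ℝ × ℝ | p.2 < 2} := isOpen_lt continuous_snd continuous_const
  have h₃ : IsOpen {p : ℝ × ℝ | -(1 / 4) < p.1} := isOpen_lt continuous_const continuous_fst
  have h₄ : IsOpen {p : ℝ × ℝ | p.1 * p.2 < 1 / 2} :=
    isOpen_lt (continuous_fst.mul continuous_snd) continuous_const
  exact h₁.inter (h₂.inter (h₃.inter h₄))

lemma eventually_mk_left_mem {x ξ : ℝ} (h : (x, ξ) ∈ symbolRegion) :
    ∀ᶠ y in 𝓝 x, (y, ξ) ∈ symbolRegion :=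
  (Continuous.prodMk_left ξ).continuousAt.eventually (isOpen_symbolRegion.mem_nhds h)

lemma eventually_mk_right_mem {x ξ : ℝ} (h : (x, ξ) ∈ symbolRegion) :
    ∀ᶠ η in 𝓝 ξ, (x, η) ∈ symbolRegion :=
  (Continuous.prodMk_right x).continuousAt.eventually (isOpen_symbolRegion.mem_nhds h)

lemma mk_mem_of_mem_uIcc {x b y ξ : ℝ} (hx : (x, ξ) ∈ symbolRegion) (hb : (b, ξ) ∈ symbolRegion)
    (hy : y ∈ Set.uIcc x b) : (y, ξ) ∈ symbolRegion := by
  obtain ⟨h0, h2, h3, h4⟩ := hx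
  obtain ⟨-, -, h5, h6⟩ := hb
  simp only at *
  rcases Set.mem_uIcc.1 hy with h | h
  · exact ⟨h0, h2, by simp only; linarith, by simp only; nlinarith⟩
  · exact ⟨h0, h2, by simp only; linarith, by simp only; nlinarith⟩

lemma sq_jap (x : ℝ) : jap x ^ 2 = 1 + x ^ 2 := Real.sq_sqrt (by positivity)

lemma jap_pos (x : ℝ) : 0 < jap x := Real.sqrt_pos.2 (by positivity)

lemma jap_ne_zero (x : ℝ) : jap x ≠ 0 := (jap_pos x).ne'

lemma one_le_jap (x : ℝ) : 1 ≤ jap x := Real.one_le_sqrt.2 (by nlinarith [sq_nonneg x])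

lemma abs_le_jap (x : ℝ) : |x| ≤ jap x := Real.abs_le_sqrt (by linarith)

lemma jap_le (x : ℝ) : jap x ≤ 1 + |x| := by
  refine Real.sqrt_le_iff.2 ⟨by positivity, ?_⟩
  nlinarith [sq_abs x, abs_nonneg x]

lemma hasDerivAt_jap (x : ℝ) : HasDerivAt jap ((jap x)⁻¹ * x) x := by
  have h : HasDerivAt (fun y : ℝ => 1 + y ^ 2) (2 * x) x := by
    simpa using (hasDerivAt_pow 2 x).const_add 1
  refine (h.sqrt (by positivity)).congr_deriv ?_
  change 2 * x / (2 * jap x) = _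
  field_simp [jap_ne_zero x]

lemma contDiff_jap {n : WithTop ℕ∞} : ContDiff ℝ n jap :=
  (contDiff_const.add (contDiff_id.pow 2)).sqrt fun x => by positivity

namespace SymbolBound

variable {m k : ℤ} {F G : ℝ → ℝ → ℝ}

lemma exists_pos (h : SymbolBound m F) :
    ∃ C, 0 < C ∧ ∀ p ∈ symbolRegion, |F p.1 p.2| ≤ C * jap p.1 ^ m := by
  obtain ⟨C, hC⟩ := h
  refine ⟨max C 1, by positivity, fun p hp => (hC p hp).trans ?_⟩
  have := zpow_pos (jap_pos p.1) m
  gcongr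
  exact le_max_left _ _

lemma add (hF : SymbolBound m F) (hG : SymbolBound m G) :
    SymbolBound m (fun x ξ => F x ξ + G x ξ) := by
  obtain ⟨C, hC⟩ := hF
  obtain ⟨D, hD⟩ := hG
  exact ⟨C + D, fun p hp => (abs_add_le _ _).trans (by linarith [hC p hp, hD p hp])⟩

lemma mul (hF : SymbolBound m F) (hG : SymbolBound k G) :
    SymbolBound (m + k) (fun x ξ => F x ξ * G x ξ) := by
  obtain ⟨C, -, hC⟩ := hF.exists_pos
  obtain ⟨D, -, hD⟩ := hG.exists_pos
  refine ⟨C * D, fun p hp => ?_⟩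
  rw [abs_mul, zpow_add₀ (jap_ne_zero _), mul_mul_mul_comm]
  exact mul_le_mul (hC p hp) (hD p hp) (abs_nonneg _) ((abs_nonneg _).trans (hC p hp))

lemma mono (hF : SymbolBound m F) (h : m ≤ k) : SymbolBound k F := by
  obtain ⟨C, hC0, hC⟩ := hF.exists_pos
  refine ⟨C, fun p hp => (hC p hp).trans ?_⟩
  gcongr
  exact one_le_jap _

end SymbolBound

namespace IsSymbol

variable {n : ℕ} {m k : ℤ} {F G : ℝ → ℝ → ℝ}

lemma bound (h : IsSymbol n m F) : SymbolBound m F := by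
  cases n with
  | zero => exact h
  | succ n => exact h.1

lemma of_succ (h : IsSymbol (n + 1) m F) : IsSymbol n m F := by
  induction n generalizing F with
  | zero => exact h.1
  | succ n ih =>
    obtain ⟨hb, G, H, hG, hH, hG', hH'⟩ := h
    exact ⟨hb, G, H, hG, hH, ih hG', ih hH'⟩

lemma mono (h : IsSymbol n m F) (hmk : m ≤ k) : IsSymbol n k F := by
  induction n generalizing F with
  | zero => exact SymbolBound.mono h hmk
  | succ n ih =>
    obtain ⟨hb, G, H, hG, hH, hG', hH'⟩ := h
    exact ⟨hb.mono hmk, G, H, hG, hH, ih hG', ih hH'⟩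

lemma congr (h : IsSymbol n m F) (hFG : ∀ p ∈ symbolRegion, G p.1 p.2 = F p.1 p.2) :
    IsSymbol n m G := by
  have hb : SymbolBound m G := by
    obtain ⟨C, hC⟩ := h.bound
    exact ⟨C, fun p hp => hFG p hp ▸ hC p hp⟩
  cases n with
  | zero => exact hb
  | succ n =>
    obtain ⟨-, G', H, hG, hH, hG', hH'⟩ := h
    refine ⟨hb, G', H, fun p hp => (hG p hp).congr_of_eventuallyEq ?_,
      fun p hp => (hH p hp).congr_of_eventuallyEq ?_, hG', hH'⟩
    · filter_upwards [eventually_mk_left_mem hp] with y hy using hFG _ hy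
    · filter_upwards [eventually_mk_right_mem hp] with y hy using hFG _ hy

lemma add (hF : IsSymbol n m F) (hG : IsSymbol n m G) :
    IsSymbol n m (fun x ξ => F x ξ + G x ξ) := by
  induction n generalizing F G with
  | zero => exact SymbolBound.add hF hG
  | succ n ih =>
    obtain ⟨hFb, F₁, F₂, hF₁, hF₂, hF₁', hF₂'⟩ := hF
    obtain ⟨hGb, G₁, G₂, hG₁, hG₂, hG₁', hG₂'⟩ := hG
    refine ⟨hFb.add hGb, _, _, fun p hp => ?_, fun p hp => ?_, ih hF₁' hG₁', ih hF₂' hG₂'⟩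
    · simpa only [mul_add] using (hF₁ p hp).fun_add (hG₁ p hp)
    · simpa only [mul_add] using (hF₂ p hp).fun_add (hG₂ p hp)

lemma mul (hF : IsSymbol n m F) (hG : IsSymbol n k G) :
    IsSymbol n (m + k) (fun x ξ => F x ξ * G x ξ) := by
  induction n generalizing F G with
  | zero => exact SymbolBound.mul hF hG
  | succ n ih =>
    have hF' := hF.of_succ
    have hG' := hG.of_succ
    obtain ⟨hFb, F₁, F₂, hF₁, hF₂, hF₁', hF₂'⟩ := hF
    obtain ⟨hGb, G₁, G₂, hG₁, hG₂, hG₁', hG₂'⟩ := hG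
    refine ⟨hFb.mul hGb, _, _, fun p hp => ?_, fun p hp => ?_,
      (ih hF₁' hG').add (ih hF' hG₁'), (ih hF₂' hG').add (ih hF' hG₂')⟩
    · exact ((hF₁ p hp).fun_mul (hG₁ p hp)).congr_deriv (by ring)
    · exact ((hF₂ p hp).fun_mul (hG₂ p hp)).congr_deriv (by ring)

lemma zero (n : ℕ) (m : ℤ) : IsSymbol n m (fun _ _ => 0) := by
  have hb : SymbolBound m (fun _ _ => 0) := ⟨0, fun p _ => by simp⟩
  induction n with
  | zero => exact hb
  | succ n ih =>
    refine ⟨hb, fun _ _ => 0, fun _ _ => 0, fun p _ => ?_, fun p _ => ?_, ih, ih⟩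
    · simpa using hasDerivAt_const p.1 (0 : ℝ)
    · simpa using hasDerivAt_const p.2 (0 : ℝ)

lemma const (n : ℕ) (c : ℝ) : IsSymbol n 0 (fun _ _ => c) := by
  have hb : SymbolBound 0 (fun _ _ => c) := ⟨|c|, fun p _ => by simp⟩
  cases n with
  | zero => exact hb
  | succ n =>
    refine ⟨hb, fun _ _ => 0, fun _ _ => 0, fun p _ => ?_, fun p _ => ?_, zero n 0, zero n 0⟩
    · simpa using hasDerivAt_const p.1 c
    · simpa using hasDerivAt_const p.2 c

lemma const_mul (c : ℝ) (hF : IsSymbol n m F) : IsSymbol n m (fun x ξ => c * F x ξ) := by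
  simpa using (const n c).mul hF

lemma neg (hF : IsSymbol n m F) : IsSymbol n m (fun x ξ => -F x ξ) := by
  simpa using hF.const_mul (-1)

/-- `⟨x⟩⁻¹` and `x / ⟨x⟩` have orders `-1` and `0`. -/
lemma inv_jap_and_div_jap (n : ℕ) :
    IsSymbol n (-1) (fun x _ => (jap x)⁻¹) ∧ IsSymbol n 0 (fun x _ => (jap x)⁻¹ * x) := by
  have hb₁ : SymbolBound (-1) (fun x _ => (jap x)⁻¹) :=
    ⟨1, fun p _ => by simp [abs_of_pos (jap_pos p.1)]⟩
  have hb₂ : SymbolBound 0 (fun x _ => (jap x)⁻¹ * x) := by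
    refine ⟨1, fun p _ => ?_⟩
    rw [abs_mul, abs_inv, abs_of_pos (jap_pos p.1), zpow_zero, mul_one, inv_mul_le_one₀ (jap_pos _)]
    exact abs_le_jap _
  induction n with
  | zero => exact ⟨hb₁, hb₂⟩
  | succ n ih =>
    obtain ⟨h₁, h₂⟩ := ih
    have key (x : ℝ) : HasDerivAt (fun y => (jap y)⁻¹) ((jap x)⁻¹ * -((jap x)⁻¹ * x * (jap x)⁻¹)) x :=
      ((hasDerivAt_jap x).fun_inv (jap_ne_zero x)).congr_deriv (by field_simp)
    refine ⟨⟨hb₁, fun x _ => -((jap x)⁻¹ * x * (jap x)⁻¹), fun _ _ => 0, fun p _ => key p.1,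
        fun p _ => by simpa using hasDerivAt_const p.2 _, ?_, zero n _⟩,
      ⟨hb₂, fun x _ => (jap x)⁻¹ * (jap x)⁻¹, fun _ _ => 0, fun p _ => ?_,
        fun p _ => by simpa using hasDerivAt_const p.2 _, ?_, zero n _⟩⟩
    · simpa using (h₂.mul h₁).neg
    · refine ((key p.1).fun_mul (hasDerivAt_id' p.1)).congr_deriv ?_
      have := sq_jap p.1
      have hne := jap_ne_zero p.1
      field_simp
      linarith
    · exact (h₁.mul h₁).mono (by norm_num)

lemma inv_jap (n : ℕ) : IsSymbol n (-1) (fun x _ => (jap x)⁻¹) := (inv_jap_and_div_jap n).1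

lemma div_jap (n : ℕ) : IsSymbol n 0 (fun x _ => (jap x)⁻¹ * x) := (inv_jap_and_div_jap n).2

lemma jap_fst (n : ℕ) : IsSymbol n 1 (fun x _ => jap x) := by
  have hb : SymbolBound 1 (fun x _ => jap x) := ⟨1, fun p _ => by simp [abs_of_pos (jap_pos p.1)]⟩
  induction n with
  | zero => exact hb
  | succ n ih =>
    refine ⟨hb, fun x _ => (jap x)⁻¹ * x * jap x, fun _ _ => 0, fun p _ => ?_,
      fun p _ => by simpa using hasDerivAt_const p.2 _, by simpa using (div_jap n).mul ih,
      zero n _⟩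
    exact (hasDerivAt_jap p.1).congr_deriv (by field_simp [jap_ne_zero p.1])

lemma fst (n : ℕ) : IsSymbol n 1 (fun x _ => x) := by
  refine ((div_jap n).mul (jap_fst n)).congr fun p _ => ?_
  field_simp [jap_ne_zero p.1]

lemma snd (n : ℕ) : IsSymbol n (-1) (fun _ ξ => ξ) := by
  have hb : SymbolBound (-1) (fun _ ξ => ξ) := by
    refine ⟨3, fun p ⟨h0, h2, h3, h4⟩ => ?_⟩
    rw [zpow_neg_one, ← div_eq_mul_inv, le_div_iff₀ (jap_pos _), abs_of_pos h0]
    have : |p.1| * p.2 ≤ 1 / 2 := by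
      rw [← abs_of_pos h0, ← abs_mul, abs_le]
      constructor <;> nlinarith
    nlinarith [jap_le p.1]
  induction n with
  | zero => exact hb
  | succ n ih =>
    refine ⟨hb, fun _ _ => 0, fun _ ξ => ξ, fun p _ => by simpa using hasDerivAt_const p.1 p.2,
      fun p hp => ?_, zero n _, ih⟩
    rw [inv_mul_cancel₀ hp.1.ne']
    exact hasDerivAt_id' p.2

lemma inv (hF : IsSymbol n 0 F) {c : ℝ} (hc : 0 < c) (h : ∀ p ∈ symbolRegion, c ≤ F p.1 p.2) :
    IsSymbol n 0 (fun x ξ => (F x ξ)⁻¹) := by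
  have hb : SymbolBound 0 (fun x ξ => (F x ξ)⁻¹) := by
    refine ⟨c⁻¹, fun p hp => ?_⟩
    have := h p hp
    rw [abs_inv, abs_of_pos (hc.trans_le this), zpow_zero, mul_one]
    gcongr
  induction n with
  | zero => exact hb
  | succ n ih =>
    have hi := ih hF.of_succ
    obtain ⟨-, G, H, hG, hH, hG', hH'⟩ := hF
    have hne p (hp : p ∈ symbolRegion) := (hc.trans_le (h p hp)).ne'
    refine ⟨hb, _, _, fun p hp => ((hG p hp).fun_inv (hne p hp)).congr_deriv ?_,
      fun p hp => ((hH p hp).fun_inv (hne p hp)).congr_deriv ?_,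
      (hG'.mul (hi.mul hi)).neg, (hH'.mul (hi.mul hi)).neg⟩
    all_goals field_simp

lemma iterate_DXR_DXIR (a b : ℕ) (hF : IsSymbol (a + b) m F) :
    SymbolBound m (DXR^[a] (DXIR^[b] F)) := by
  have hR {n : ℕ} {F : ℝ → ℝ → ℝ} (hF : IsSymbol (n + 1) m F) : IsSymbol n m (DXR F) := by
    obtain ⟨-, G, H, hG, hH, hG', hH'⟩ := hF
    refine hG'.congr fun p hp => ?_
    rw [DXR, (hG p hp).deriv, mul_inv_cancel_left₀ (jap_ne_zero _)]
  have hI {n : ℕ} {F : ℝ → ℝ → ℝ} (hF : IsSymbol (n + 1) m F) : IsSymbol n m (DXIR F) := by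
    obtain ⟨-, G, H, hG, hH, hG', hH'⟩ := hF
    refine hH'.congr fun p hp => ?_
    rw [DXIR, (hH p hp).deriv, mul_inv_cancel_left₀ hp.1.ne']
  induction b generalizing F with
  | succ b ih => exact ih (hI hF)
  | zero =>
    induction a generalizing F with
    | zero => exact hF.bound
    | succ a ih => exact ih (hR (n := a) (by simpa using hF))

lemma continuousAt_left (hF : IsSymbol (n + 1) m F) {p : ℝ × ℝ} (hp : p ∈ symbolRegion) :
    ContinuousAt (fun y => F y p.2) p.1 := by
  obtain ⟨-, G, H, hG, -⟩ := hF
  exact (hG p hp).continuousAt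

lemma continuousOn_uIcc (hF : IsSymbol (n + 1) m F) {x b ξ : ℝ} (hx : (x, ξ) ∈ symbolRegion)
    (hb : (b, ξ) ∈ symbolRegion) : ContinuousOn (fun y => F y ξ) (Set.uIcc x b) :=
  fun y hy => (hF.continuousAt_left (p := (y, ξ))
    (mk_mem_of_mem_uIcc hx hb hy)).continuousWithinAt

lemma continuousAt (hF : IsSymbol (n + 1) m F) {p : ℝ × ℝ} (hp : p ∈ symbolRegion) :
    ContinuousAt (fun q : ℝ × ℝ => F q.1 q.2) p := by
  obtain ⟨-, G, H, hG, hH, hG', -⟩ := hF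
  obtain ⟨x, ξ⟩ := p
  obtain ⟨C, hC0, hC⟩ := hG'.bound.exists_pos
  set B : ℝ → ℝ := fun y => (jap y)⁻¹ * (C * jap y ^ m) with hB
  have hBc : Continuous B := by
    have hj : Continuous jap := (contDiff_jap (n := 0)).continuous
    exact (hj.inv₀ jap_ne_zero).mul (continuous_const.mul (hj.zpow₀ m fun y => .inl (jap_ne_zero y)))
  have hBx : ∀ᶠ y in 𝓝 x, B y ≤ B x + 1 :=
    (hBc.tendsto x).eventually (eventually_le_nhds (by linarith))
  obtain ⟨r, hr, hball⟩ := Metric.eventually_nhds_iff_ball.1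
    ((isOpen_symbolRegion.eventually_mem hp).and (hBx.prod_inl_nhds ξ))
  have hlip : ∀ᶠ q : ℝ × ℝ in 𝓝 (x, ξ), |F q.1 q.2 - F x q.2| ≤ (B x + 1) * |q.1 - x| := by
    filter_upwards [Metric.ball_mem_nhds (x, ξ) hr] with q hq
    rw [← ball_prod_same] at hq
    refine (convex_ball x r).norm_image_sub_le_of_norm_hasDerivWithin_le
      (f := fun y => F y q.2) (f' := fun y => (jap y)⁻¹ * G y q.2) (fun y hy => ?_)
      (fun y hy => ?_) (Metric.mem_ball_self hr) hq.1
    · have := hball (y, q.2) (by rw [← ball_prod_same]; exact ⟨hy, hq.2⟩)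
      exact (hG _ this.1).hasDerivWithinAt
    · have := hball (y, q.2) (by rw [← ball_prod_same]; exact ⟨hy, hq.2⟩)
      refine le_trans ?_ this.2
      rw [Real.norm_eq_abs, abs_mul, abs_of_pos (inv_pos.2 (jap_pos y)), hB]
      exact mul_le_mul_of_nonneg_left (hC _ this.1) (inv_pos.2 (jap_pos y)).le
  have h₁ : Tendsto (fun q : ℝ × ℝ => F q.1 q.2 - F x q.2) (𝓝 (x, ξ)) (𝓝 0) := by
    refine squeeze_zero_norm' hlip ?_
    have : Continuous fun q : ℝ × ℝ => (B x + 1) * |q.1 - x| := by fun_prop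
    simpa using this.tendsto (x, ξ)
  have h₂ : Tendsto (fun q : ℝ × ℝ => F x q.2) (𝓝 (x, ξ)) (𝓝 (F x ξ)) :=
    (hH _ hp).continuousAt.tendsto.comp continuous_snd.continuousAt
  simpa [ContinuousAt] using h₁.add h₂

end IsSymbol

/-- A function of two variables is differentiable at a point if both partial derivatives exist
there and the first one exists nearby and is continuous. -/
lemma hasFDerivAt_of_partial {F F' : ℝ → ℝ → ℝ} {p : ℝ × ℝ} {d : ℝ}
    (h₁ : ∀ᶠ q in 𝓝 p, HasDerivAt (fun y => F y q.2) (F' q.1 q.2) q.1)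
    (hc : ContinuousAt (fun q : ℝ × ℝ => F' q.1 q.2) p) (h₂ : HasDerivAt (F p.1) d p.2) :
    HasFDerivAt (fun q : ℝ × ℝ => F q.1 q.2)
      (F' p.1 p.2 • ContinuousLinearMap.fst ℝ ℝ ℝ + d • ContinuousLinearMap.snd ℝ ℝ ℝ) p := by
  have key : (fun q : ℝ × ℝ => F q.1 q.2 - F p.1 q.2 - F' p.1 p.2 * (q.1 - p.1)) =o[𝓝 p]
      fun q => q.1 - p.1 := by
    refine Asymptotics.isLittleO_iff.2 fun ε hε => ?_
    have hc' : ∀ᶠ q in 𝓝 p, |F' q.1 q.2 - F' p.1 p.2| ≤ ε :=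
      (hc.eventually (Metric.closedBall_mem_nhds _ hε))
    obtain ⟨r, hr, hball⟩ := Metric.eventually_nhds_iff_ball.1 (h₁.and hc')
    filter_upwards [Metric.ball_mem_nhds p hr] with q hq
    rw [← Prod.mk.eta (p := p), ← ball_prod_same] at hq
    have hmem : ∀ y ∈ Metric.ball p.1 r, (y, q.2) ∈ Metric.ball p r := fun y hy => by
      rw [← Prod.mk.eta (p := p), ← ball_prod_same]
      exact ⟨hy, hq.2⟩
    have := (convex_ball p.1 r).norm_image_sub_le_of_norm_hasDerivWithin_le
      (f := fun y => F y q.2 - F' p.1 p.2 * y) (f' := fun y => F' y q.2 - F' p.1 p.2)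
      (fun y hy => ?_) (fun y hy => (hball _ (hmem y hy)).2) (Metric.mem_ball_self hr) hq.1
    · refine (le_of_eq (congrArg norm ?_)).trans this
      ring
    · simpa using ((hball _ (hmem y hy)).1.fun_sub
        ((hasDerivAt_id y).const_mul (F' p.1 p.2))).hasDerivWithinAt
  have h₃ := (hasDerivAt_iff_isLittleO.1 h₂).comp_tendsto (continuous_snd.tendsto p)
  have e₁ : (fun q : ℝ × ℝ => q.1 - p.1) =O[𝓝 p] fun q => q - p :=
    Asymptotics.isBigO_of_le _ fun q => norm_fst_le (q - p)
  have e₂ : (fun q : ℝ × ℝ => q.2 - p.2) =O[𝓝 p] fun q => q - p :=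
    Asymptotics.isBigO_of_le _ fun q => norm_snd_le (q - p)
  refine .of_isLittleO (((key.trans_isBigO e₁).add (h₃.trans_isBigO e₂)).congr_left fun q => ?_)
  simp
  ring

namespace IsSymbol

variable {n : ℕ} {m k : ℤ} {F G : ℝ → ℝ → ℝ}

lemma hasFDerivAt {H : ℝ → ℝ → ℝ}
    (hG : ∀ p ∈ symbolRegion, HasDerivAt (fun y => F y p.2) ((jap p.1)⁻¹ * G p.1 p.2) p.1)
    (hH : ∀ p ∈ symbolRegion, HasDerivAt (F p.1) (p.2⁻¹ * H p.1 p.2) p.2)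
    (hG' : IsSymbol (n + 1) m G) {p : ℝ × ℝ} (hp : p ∈ symbolRegion) :
    HasFDerivAt (fun q : ℝ × ℝ => F q.1 q.2)
      (((jap p.1)⁻¹ * G p.1 p.2) • ContinuousLinearMap.fst ℝ ℝ ℝ +
        (p.2⁻¹ * H p.1 p.2) • ContinuousLinearMap.snd ℝ ℝ ℝ) p := by
  refine hasFDerivAt_of_partial (F' := fun x ξ => (jap x)⁻¹ * G x ξ) ?_ ?_ (hH p hp)
  · filter_upwards [isOpen_symbolRegion.mem_nhds hp] with q hq using hG q hq
  · exact ((inv_jap (n + 1)).mul hG').continuousAt hp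

lemma contDiffOn (hF : IsSymbol (n + 1) m F) :
    ContDiffOn ℝ n (fun q : ℝ × ℝ => F q.1 q.2) symbolRegion := by
  induction n generalizing F with
  | zero =>
    exact contDiffOn_zero.2 fun p hp => (hF.continuousAt hp).continuousWithinAt
  | succ n ih =>
    obtain ⟨-, G, H, hG, hH, hG', hH'⟩ := hF
    rw [Nat.cast_succ]
    refine (contDiffOn_succ_iff_hasFDerivWithinAt_of_uniqueDiffOn
      isOpen_symbolRegion.uniqueDiffOn).2 ⟨fun h => by simp at h, _, ?_,
        fun p hp => (hasFDerivAt hG hH hG' hp).hasFDerivWithinAt⟩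
    refine ContDiffOn.add (ContDiffOn.smul (ContDiffOn.mul ?_ (ih hG')) contDiffOn_const)
      (ContDiffOn.smul (ContDiffOn.mul ?_ (ih hH')) contDiffOn_const)
    · exact ((contDiff_jap.comp contDiff_fst).inv fun p => jap_ne_zero p.1).contDiffOn
    · exact contDiffOn_snd.inv fun p hp => hp.1.ne'

end IsSymbol

lemma endpoint_mem {x ξ : ℝ} (h : (x, ξ) ∈ symbolRegion) : (1 / 4 / ξ, ξ) ∈ symbolRegion := by
  obtain ⟨h0, h2, -, -⟩ := h
  have : 0 < 1 / 4 / ξ := by positivity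
  refine ⟨h0, h2, by simp only; linarith, ?_⟩
  simp only at h0 ⊢
  rw [div_mul_cancel₀ _ h0.ne']
  norm_num

lemma abs_le_two_mul_endpoint {p : ℝ × ℝ} (h : p ∈ symbolRegion) : |p.1| ≤ 2 * (1 / 4 / p.2) := by
  obtain ⟨h0, h2, h3, h4⟩ := h
  rw [← mul_div_assoc, le_div_iff₀ h0, ← abs_of_pos h0, ← abs_mul, abs_le]
  constructor <;> nlinarith

lemma jap_le_two_mul_jap_endpoint {p : ℝ × ℝ} (h : p ∈ symbolRegion) :
    jap p.1 ≤ 2 * jap (1 / 4 / p.2) := by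
  refine Real.sqrt_le_iff.2 ⟨by linarith [jap_pos (1 / 4 / p.2)], ?_⟩
  rw [mul_pow, sq_jap]
  nlinarith [sq_abs p.1, abs_nonneg p.1, abs_le_two_mul_endpoint h]

lemma hasDerivAt_endpoint {ξ : ℝ} (hξ : ξ ≠ 0) :
    HasDerivAt (fun η : ℝ => 1 / 4 / η) (-(ξ⁻¹ * (1 / 4 / ξ))) ξ := by
  have := (hasDerivAt_inv hξ).const_mul (1 / 4)
  refine (this.congr_deriv (by field_simp)).congr_of_eventuallyEq (.of_forall fun η => ?_)
  simp [div_eq_mul_inv]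

lemma jap_le_two_mul_one_add {x : ℝ} (hx : -(1 / 4) < x) : jap x ≤ 2 * (1 + x) := by
  refine Real.sqrt_le_iff.2 ⟨by linarith, ?_⟩
  nlinarith

lemma one_add_le_two_mul_jap (x : ℝ) : 1 + x ≤ 2 * jap x := by
  linarith [one_le_jap x, abs_le_jap x, le_abs_self x]

lemma abs_integral_one_add_zpow_le {x b : ℝ} (hx : -1 < x) (hb : -1 < b) :
    |∫ y in x..b, (1 + y) ^ (-4 : ℤ)| ≤ (1 + x) ^ (-3 : ℤ) + (1 + b) ^ (-3 : ℤ) := by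
  have hpos : ∀ y ∈ Set.uIcc x b, 0 < 1 + y := fun y hy => by
    rcases Set.mem_uIcc.1 hy with h | h <;> linarith
  have hd : ∀ y ∈ Set.uIcc x b,
      HasDerivAt (fun y : ℝ => -(1 / 3) * (1 + y) ^ (-3 : ℤ)) ((1 + y) ^ (-4 : ℤ)) y :=
    fun y hy => by
      have := ((hasDerivAt_zpow (-3) (1 + y) (.inl (hpos y hy).ne')).comp_const_add 1 y).const_mul
        (-(1 / 3))
      refine this.congr_deriv ?_
      norm_num
      ring
  rw [intervalIntegral.integral_eq_sub_of_hasDerivAt hd]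
  · have h₁ : 0 < (1 + x) ^ (-3 : ℤ) := zpow_pos (by linarith) _
    have h₂ : 0 < (1 + b) ^ (-3 : ℤ) := zpow_pos (by linarith) _
    rw [abs_le]
    constructor <;> linarith
  · refine ContinuousOn.intervalIntegrable fun y hy => ?_
    exact ((continuousAt_const.add continuousAt_id).zpow₀ _
      (.inl (hpos y hy).ne')).continuousWithinAt

namespace SymbolBound

variable {m : ℤ} {F : ℝ → ℝ → ℝ}

lemma restrict_endpoint (hm : m ≤ 0) (hF : SymbolBound m F) :
    SymbolBound m (fun _ ξ => F (1 / 4 / ξ) ξ) := by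
  obtain ⟨C, hC0, hC⟩ := hF.exists_pos
  refine ⟨C * 2 ^ (-m), fun p hp => (hC _ (endpoint_mem hp)).trans ?_⟩
  rw [mul_assoc]
  refine mul_le_mul_of_nonneg_left ?_ hC0.le
  obtain ⟨j, rfl⟩ : ∃ j : ℕ, m = -(j : ℤ) := ⟨(-m).toNat, by omega⟩
  have h₁ := jap_pos p.1
  have h₂ := jap_pos (1 / 4 / p.2)
  simp only [zpow_neg, zpow_natCast, neg_neg]
  rw [← div_eq_mul_inv, le_div_iff₀ (by positivity), inv_mul_le_iff₀ (by positivity), ← mul_pow,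
    mul_comm]
  exact pow_le_pow_left₀ h₁.le (jap_le_two_mul_jap_endpoint hp) j

lemma integral_endpoint (hF : SymbolBound (-4) F) :
    SymbolBound (-3) (fun x ξ => ∫ y in x..(1 / 4 / ξ), F y ξ) := by
  obtain ⟨C, hC0, hC⟩ := hF.exists_pos
  refine ⟨C * 16 * (8 + 64), fun p hp => ?_⟩
  have hx : -(1 / 4) < p.1 := hp.2.2.1
  have hb := (endpoint_mem hp).2.2.1
  simp only at hb
  have hle : ∀ y ∈ Set.uIoc p.1 (1 / 4 / p.2), |F y p.2| ≤ C * 16 * (1 + y) ^ (-4 : ℤ) :=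
    fun y hy => by
      have hmem := mk_mem_of_mem_uIcc hp (endpoint_mem hp) (Set.uIoc_subset_uIcc hy)
      have hy : 0 < 1 + y := by linarith [hmem.2.2.1]
      refine (hC _ hmem).trans ?_
      rw [mul_assoc]
      refine mul_le_mul_of_nonneg_left ?_ hC0.le
      have := jap_pos y
      have h16 : (16 : ℝ) = 2 ^ 4 := by norm_num
      simp only [zpow_neg, zpow_ofNat, h16]
      rw [← div_eq_mul_inv, le_div_iff₀ (by positivity), inv_mul_le_iff₀ (by positivity), ← mul_pow,
        mul_comm]
      exact pow_le_pow_left₀ hy.le (one_add_le_two_mul_jap y) 4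
  have hint : IntervalIntegrable (fun y : ℝ => C * 16 * (1 + y) ^ (-4 : ℤ)) volume p.1
      (1 / 4 / p.2) := by
    refine ContinuousOn.intervalIntegrable fun y hy => ?_
    have hmem := mk_mem_of_mem_uIcc hp (endpoint_mem hp) hy
    have hy : 0 < 1 + y := by linarith [hmem.2.2.1]
    exact (continuousAt_const.mul ((continuousAt_const.add continuousAt_id).zpow₀ _
      (.inl hy.ne'))).continuousWithinAt
  have cube {u v : ℝ} (hu : 0 < u) (hv : 0 < v) {c : ℝ} (hc : 0 < c) (h : u ≤ c * v) :
      v ^ (-3 : ℤ) ≤ c ^ 3 * u ^ (-3 : ℤ) := by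
    simp only [zpow_neg, zpow_ofNat]
    rw [← div_eq_mul_inv, le_div_iff₀ (by positivity), inv_mul_le_iff₀ (by positivity), ← mul_pow,
      mul_comm v]
    exact pow_le_pow_left₀ hu.le h 3
  have h₁ := cube (jap_pos p.1) (by linarith) two_pos (jap_le_two_mul_one_add hx)
  have h₂ : (1 + 1 / 4 / p.2) ^ (-3 : ℤ) ≤ 4 ^ 3 * jap p.1 ^ (-3 : ℤ) :=
    cube (jap_pos p.1) (by linarith) four_pos
      (by linarith [jap_le_two_mul_jap_endpoint hp, jap_le_two_mul_one_add hb])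
  calc |∫ y in p.1..(1 / 4 / p.2), F y p.2|
      ≤ |∫ y in p.1..(1 / 4 / p.2), C * 16 * (1 + y) ^ (-4 : ℤ)| :=
        (Real.norm_eq_abs _).symm.le.trans <| intervalIntegral.norm_integral_le_abs_of_norm_le
          ((ae_restrict_iff' measurableSet_uIoc).2 (.of_forall hle)) hint
    _ = C * 16 * |∫ y in p.1..(1 / 4 / p.2), (1 + y) ^ (-4 : ℤ)| := by
        rw [intervalIntegral.integral_const_mul, abs_mul, abs_of_pos (by positivity : 0 < C * 16)]
    _ ≤ C * 16 * ((8 + 64) * jap p.1 ^ (-3 : ℤ)) := by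
        refine mul_le_mul_of_nonneg_left ?_ (by positivity)
        refine (abs_integral_one_add_zpow_le (by linarith) (by linarith)).trans ?_
        linarith
    _ = _ := by ring

end SymbolBound

namespace IsSymbol

variable {n : ℕ} {m k : ℤ} {F G : ℝ → ℝ → ℝ}

lemma restrict_endpoint (hm : m ≤ 0) (hF : IsSymbol (n + 1) m F) :
    IsSymbol n m (fun _ ξ => F (1 / 4 / ξ) ξ) := by
  have hb := hF.bound.restrict_endpoint hm
  induction n generalizing F with
  | zero => exact hb
  | succ n ih =>
    obtain ⟨-, G, H, hG, hH, hG', hH'⟩ := hF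
    have hK : IsSymbol (n + 1) m fun x ξ => -((jap x)⁻¹ * x * G x ξ) + H x ξ :=
      (IsSymbol.neg (by simpa using (div_jap (n + 1)).mul hG')).add hH'
    refine ⟨hb, fun _ _ => 0, _, fun p _ => by simpa using hasDerivAt_const p.1 _,
      fun p hp => ?_, zero n m, ih hK (hK.bound.restrict_endpoint hm)⟩
    have hc := (hasFDerivAt hG hH hG' (endpoint_mem hp)).comp_hasDerivAt_of_eq p.2
      ((hasDerivAt_endpoint hp.1.ne').prodMk (hasDerivAt_id' p.2)) rfl
    refine hc.congr_deriv ?_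
    simp
    ring

lemma intervalIntegrable (hF : IsSymbol (n + 1) m F) {x b ξ : ℝ} (hx : (x, ξ) ∈ symbolRegion)
    (hb : (b, ξ) ∈ symbolRegion) : IntervalIntegrable (fun y => F y ξ) volume x b :=
  (hF.continuousOn_uIcc hx hb).intervalIntegrable

lemma stronglyMeasurableAtFilter (hF : IsSymbol (n + 1) m F) {x ξ : ℝ}
    (hx : (x, ξ) ∈ symbolRegion) :
    StronglyMeasurableAtFilter (fun y => F y ξ) (𝓝 x) volume := by
  refine ContinuousOn.stronglyMeasurableAtFilter (s := {y | (y, ξ) ∈ symbolRegion})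
    (isOpen_symbolRegion.preimage (Continuous.prodMk_left ξ)) (fun y hy => ?_) x hx
  exact (hF.continuousAt_left (p := (y, ξ)) hy).continuousWithinAt

lemma hasDerivAt_integral_param {H : ℝ → ℝ → ℝ} (hF : IsSymbol (n + 1) m F)
    (hH : ∀ p ∈ symbolRegion, HasDerivAt (F p.1) (p.2⁻¹ * H p.1 p.2) p.2)
    (hH' : IsSymbol (n + 1) m H) {x b ξ : ℝ} (hx : (x, ξ) ∈ symbolRegion)
    (hb : (b, ξ) ∈ symbolRegion) :
    HasDerivAt (fun η => ∫ y in x..b, F y η) (ξ⁻¹ * ∫ y in x..b, H y ξ) ξ := by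
  have hξ : 0 < ξ := hx.1
  obtain ⟨C, hC0, hC⟩ := hH'.bound.exists_pos
  have hev : ∀ᶠ η in 𝓝 ξ, (x, η) ∈ symbolRegion ∧ (b, η) ∈ symbolRegion ∧ ξ / 2 < η :=
    (eventually_mk_right_mem hx).and ((eventually_mk_right_mem hb).and
      (eventually_gt_nhds (by linarith)))
  rw [← intervalIntegral.integral_const_mul]
  refine (intervalIntegral.hasDerivAt_integral_of_dominated_loc_of_deriv_le
    (F := fun η y => F y η) (F' := fun η y => η⁻¹ * H y η)
    (bound := fun y => (ξ / 2)⁻¹ * (C * jap y ^ m)) hev ?_ (hF.intervalIntegrable hx hb) ?_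
    (.of_forall fun y hy η hη => ?_) ?_ (.of_forall fun y hy η hη => ?_)).2
  · filter_upwards [hev] with η hη
    exact ((hF.continuousOn_uIcc hη.1 hη.2.1).mono Set.uIoc_subset_uIcc).aestronglyMeasurable
      measurableSet_uIoc
  · exact ((continuousOn_const.mul (hH'.continuousOn_uIcc hx hb)).mono
      Set.uIoc_subset_uIcc).aestronglyMeasurable measurableSet_uIoc
  · obtain ⟨h₁, h₂, h₃⟩ := hη
    have hη0 : 0 < η := h₁.1
    rw [Real.norm_eq_abs, abs_mul, abs_of_pos (inv_pos.2 hη0)]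
    exact mul_le_mul (by gcongr) (hC _ (mk_mem_of_mem_uIcc h₁ h₂ (Set.uIoc_subset_uIcc hy)))
      (abs_nonneg _) (by positivity)
  · have hj : Continuous jap := (contDiff_jap (n := 0)).continuous
    exact (continuous_const.mul (continuous_const.mul
      (hj.zpow₀ m fun y => .inl (jap_ne_zero y)))).intervalIntegrable _ _
  · exact hH _ (mk_mem_of_mem_uIcc hη.1 hη.2.1 (Set.uIoc_subset_uIcc hy))

lemma hasDerivAt_integral_endpoint {H : ℝ → ℝ → ℝ} (hF : IsSymbol (n + 1) m F)
    (hH : ∀ p ∈ symbolRegion, HasDerivAt (F p.1) (p.2⁻¹ * H p.1 p.2) p.2)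
    (hH' : IsSymbol (n + 1) m H) {p : ℝ × ℝ} (hp : p ∈ symbolRegion) :
    HasDerivAt (fun ξ => ∫ y in p.1..(1 / 4 / ξ), F y ξ)
      (p.2⁻¹ * (-(1 / 4 / p.2 * F (1 / 4 / p.2) p.2) + ∫ y in p.1..(1 / 4 / p.2), H y p.2))
      p.2 := by
  have he := endpoint_mem hp
  have hX : ∀ᶠ q : ℝ × ℝ in 𝓝 (1 / 4 / p.2, p.2),
      HasDerivAt (fun X => ∫ y in p.1..X, F y q.2) (F q.1 q.2) q.1 := by
    filter_upwards [isOpen_symbolRegion.mem_nhds he,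
      (continuous_snd.tendsto _).eventually (eventually_mk_right_mem hp)] with q hq hq'
    exact intervalIntegral.integral_hasDerivAt_right (hF.intervalIntegrable hq' hq)
      (hF.stronglyMeasurableAtFilter hq) (hF.continuousAt_left hq)
  have hd := hasFDerivAt_of_partial (F := fun X ξ => ∫ y in p.1..X, F y ξ) hX
    (hF.continuousAt he) (hasDerivAt_integral_param hF hH hH' hp he)
  have hc := hd.comp_hasDerivAt_of_eq p.2
    ((hasDerivAt_endpoint hp.1.ne').prodMk (hasDerivAt_id' p.2)) rfl
  refine hc.congr_deriv ?_
  simp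
  ring

lemma hasDerivAt_integral_left (hF : IsSymbol (n + 1) m F) {p : ℝ × ℝ} (hp : p ∈ symbolRegion) :
    HasDerivAt (fun x => ∫ y in x..(1 / 4 / p.2), F y p.2) (-F p.1 p.2) p.1 :=
  intervalIntegral.integral_hasDerivAt_left (hF.intervalIntegrable hp (endpoint_mem hp))
    (hF.stronglyMeasurableAtFilter hp) (hF.continuousAt_left hp)

lemma integral_endpoint (hF : IsSymbol (n + 1) (-4) F) :
    IsSymbol n (-3) (fun x ξ => ∫ y in x..(1 / 4 / ξ), F y ξ) := by
  induction n generalizing F with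
  | zero => exact hF.bound.integral_endpoint
  | succ n ih =>
    have hF' := hF.of_succ
    obtain ⟨-, G, H, hG, hH, hG', hH'⟩ := id hF
    refine ⟨hF.bound.integral_endpoint, fun x ξ => -(jap x * F x ξ),
      fun x ξ => -(1 / 4 / ξ * F (1 / 4 / ξ) ξ) + ∫ y in x..(1 / 4 / ξ), H y ξ,
      fun p hp => (hF.hasDerivAt_integral_left hp).congr_deriv ?_,
      fun p hp => hasDerivAt_integral_endpoint hF' hH hH' hp,
      ((jap_fst n).mul hF'.of_succ).neg.mono (by norm_num), ?_⟩
    · field_simp [jap_ne_zero p.1]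
    · exact (IsSymbol.neg (restrict_endpoint (by norm_num) ((fst (n + 1)).mul hF'))).add (ih hH')

end IsSymbol

end Symbols

section VolterraIteration

/-- Iterates of `g ↦ ∫₀ˣ (1+y²)⁻² ∫₀ʸ (1+s²)² g(s) ds dy` applied to the constant `1`. -/
def volterraIter : ℕ → ℝ → ℝ
  | 0 => fun _ => 1
  | k + 1 => fun x => ∫ y in (0)..x, ((1 + y ^ 2) ^ 2)⁻¹ *
      ∫ s in (0)..y, (1 + s ^ 2) ^ 2 * volterraIter k s

/-- The derivative of `volterraIter (k + 1)`. -/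
def volterraIterDeriv (k : ℕ) (y : ℝ) : ℝ :=
  ((1 + y ^ 2) ^ 2)⁻¹ * ∫ s in (0)..y, (1 + s ^ 2) ^ 2 * volterraIter k s

lemma hasDerivAt_volterraIterDeriv_of_continuous {k : ℕ} (h : Continuous (volterraIter k))
    (x : ℝ) : HasDerivAt (volterraIterDeriv k)
      (volterraIter k x - 4 * x / (1 + x ^ 2) * volterraIterDeriv k x) x := by
  have hc : Continuous fun s : ℝ => (1 + s ^ 2) ^ 2 * volterraIter k s := by fun_prop
  have h₁ := hc.integral_hasStrictDerivAt 0 x |>.hasDerivAt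
  have h₂ : HasDerivAt (fun y : ℝ => (1 + y ^ 2) ^ 2) (2 * (1 + x ^ 2) * (2 * x)) x := by
    simpa using ((hasDerivAt_pow 2 x).const_add 1).fun_pow 2
  refine ((h₂.fun_inv (by positivity)).fun_mul h₁).congr_deriv ?_
  have : (1 + x ^ 2) ≠ 0 := by positivity
  rw [volterraIterDeriv]
  field_simp
  ring

lemma continuous_volterraIter (k : ℕ) : Continuous (volterraIter k) := by
  induction k with
  | zero => exact continuous_const
  | succ k ih =>
    have hc : Continuous (volterraIterDeriv k) := continuous_iff_continuousAt.2 fun x =>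
      (hasDerivAt_volterraIterDeriv_of_continuous ih x).continuousAt
    exact continuous_iff_continuousAt.2 fun x =>
      (hc.integral_hasStrictDerivAt 0 x).hasDerivAt.continuousAt

lemma hasDerivAt_volterraIterDeriv (k : ℕ) (x : ℝ) : HasDerivAt (volterraIterDeriv k)
    (volterraIter k x - 4 * x / (1 + x ^ 2) * volterraIterDeriv k x) x :=
  hasDerivAt_volterraIterDeriv_of_continuous (continuous_volterraIter k) x

lemma hasDerivAt_volterraIter_succ (k : ℕ) (x : ℝ) :
    HasDerivAt (volterraIter (k + 1)) (volterraIterDeriv k x) x := by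
  have hc : Continuous (volterraIterDeriv k) := continuous_iff_continuousAt.2 fun x =>
    (hasDerivAt_volterraIterDeriv k x).continuousAt
  exact (hc.integral_hasStrictDerivAt 0 x).hasDerivAt

lemma abs_volterraIterDeriv_le_of {k : ℕ} (h : ∀ x, |volterraIter k x| ≤ (x ^ 2) ^ k / k.factorial)
    (x : ℝ) : |volterraIterDeriv k x| ≤ |x| * ((x ^ 2) ^ k / k.factorial) := by
  have hle : ‖∫ s in (0)..x, (1 + s ^ 2) ^ 2 * volterraIter k s‖ ≤
      (1 + x ^ 2) ^ 2 * ((x ^ 2) ^ k / k.factorial) * |x - 0| := by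
    refine intervalIntegral.norm_integral_le_of_norm_le_const fun s hs => ?_
    have hsx : s ^ 2 ≤ x ^ 2 := by
      rcases Set.mem_uIoc.1 hs with hs | hs <;> nlinarith
    rw [Real.norm_eq_abs, abs_mul, abs_of_nonneg (by positivity)]
    refine mul_le_mul (by gcongr) ((h s).trans (by gcongr)) (abs_nonneg _) (by positivity)
  have hp : 0 < (1 + x ^ 2) ^ 2 := by positivity
  rw [volterraIterDeriv, abs_mul, abs_of_pos (inv_pos.2 hp), inv_mul_le_iff₀ hp]
  refine hle.trans (le_of_eq ?_)
  rw [sub_zero]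
  ring

lemma abs_volterraIter_le (k : ℕ) (x : ℝ) :
    |volterraIter k x| ≤ (x ^ 2) ^ k / k.factorial := by
  induction k generalizing x with
  | zero => simp [volterraIter]
  | succ k ih =>
    have h₁ : ‖∫ y in (0)..x, volterraIterDeriv k y‖ ≤
        ∫ y in Set.uIoc 0 x, |y - 0| ^ (2 * k + 1) * (k.factorial : ℝ)⁻¹ := by
      refine intervalIntegral.norm_integral_le_integral_norm_uIoc.trans ?_
      refine setIntegral_mono_on ?_ ?_ measurableSet_uIoc fun y _ => ?_
      · refine (Continuous.integrableOn_uIoc ?_)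
        exact (continuous_iff_continuousAt.2 fun x =>
          (hasDerivAt_volterraIterDeriv k x).continuousAt).norm
      · exact Continuous.integrableOn_uIoc (by fun_prop)
      · refine (abs_volterraIterDeriv_le_of ih y).trans (le_of_eq ?_)
        rw [sub_zero, pow_succ |y|, pow_mul, sq_abs]
        ring
    refine h₁.trans ?_
    rw [integral_mul_const, integral_pow_abs_sub_uIoc, sub_zero, Nat.factorial_succ,
      show 2 * k + 1 + 1 = 2 * (k + 1) by ring, pow_mul, sq_abs, ← div_eq_mul_inv, div_div]
    have := k.factorial_pos
    push_cast
    gcongr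
    linarith [(k.cast_nonneg : (0 : ℝ) ≤ k)]

lemma abs_volterraIterDeriv_le (k : ℕ) (x : ℝ) :
    |volterraIterDeriv k x| ≤ |x| * ((x ^ 2) ^ k / k.factorial) :=
  abs_volterraIterDeriv_le_of (abs_volterraIter_le k) x

lemma abs_volterraIter_succ_le (k : ℕ) (x : ℝ) :
    |volterraIter (k + 1) x| ≤ x ^ 2 * ((x ^ 2) ^ k / k.factorial) := by
  refine (abs_volterraIter_le (k + 1) x).trans ?_
  rw [pow_succ', mul_div_assoc]
  have : (k.factorial : ℝ) ≤ (k + 1).factorial := by exact_mod_cast Nat.factorial_le k.le_succ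
  have := k.factorial_pos
  gcongr

end VolterraIteration

section Series

/-- The even power series `∑ c k * ξ ^ (2 * k) * f k`. -/
def evenSeries (c f : ℕ → ℝ) (ξ : ℝ) : ℝ := ∑' k, c k * (ξ ^ (2 * k) * f k)

/-- `c` grows at most geometrically. -/
def GeomBounded (c : ℕ → ℝ) : Prop := ∃ M A : ℝ, 0 ≤ M ∧ 0 ≤ A ∧ ∀ k, |c k| ≤ M * A ^ k

lemma GeomBounded.shift {c : ℕ → ℝ} (h : GeomBounded c) : GeomBounded fun k => c (k + 1) := by
  obtain ⟨M, A, hM, hA, h⟩ := h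
  exact ⟨M * A, A, by positivity, hA, fun k => (h (k + 1)).trans_eq (by ring)⟩

lemma GeomBounded.two_mul_nat {c : ℕ → ℝ} (h : GeomBounded c) :
    GeomBounded fun k => 2 * k * c k := by
  obtain ⟨M, A, hM, hA, h⟩ := h
  refine ⟨2 * M, 2 * A, by positivity, by positivity, fun k => ?_⟩
  have hk : (k : ℝ) ≤ 2 ^ k := by exact_mod_cast Nat.lt_two_pow_self.le
  calc |2 * k * c k| = 2 * k * |c k| := by rw [abs_mul, abs_of_nonneg (by positivity)]
    _ ≤ 2 * 2 ^ k * (M * A ^ k) := by gcongr; exact h k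
    _ = 2 * M * (2 * A) ^ k := by rw [mul_pow]; ring

lemma abs_evenSeries_term_le {c : ℕ → ℝ} {M A K L R ξ v : ℝ} (hM : 0 ≤ M) (hA : 0 ≤ A)
    {k : ℕ} (hc : |c k| ≤ M * A ^ k) (hξ : |ξ| ≤ R) (hv : |v| ≤ K * (L ^ k / k.factorial)) :
    |c k * (ξ ^ (2 * k) * v)| ≤ M * K * ((A * R ^ 2 * L) ^ k / k.factorial) := by
  have hR : 0 ≤ R := (abs_nonneg _).trans hξ
  calc |c k * (ξ ^ (2 * k) * v)| = |c k| * (|ξ| ^ (2 * k) * |v|) := by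
        rw [abs_mul, abs_mul, abs_pow]
    _ ≤ M * A ^ k * (R ^ (2 * k) * (K * (L ^ k / k.factorial))) := by gcongr
    _ = _ := by rw [mul_pow, mul_pow, pow_mul]; ring

lemma summable_exp_majorant (M B : ℝ) :
    Summable fun k : ℕ => M * (B ^ k / k.factorial) :=
  (Real.summable_pow_div_factorial B).mul_left M

variable {c f : ℕ → ℝ} {K L : ℝ}

lemma summable_evenSeries (hc : GeomBounded c) (hf : ∀ k, |f k| ≤ K * (L ^ k / k.factorial))
    (ξ : ℝ) : Summable fun k => c k * (ξ ^ (2 * k) * f k) := by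
  obtain ⟨M, A, hM, hA, h⟩ := hc
  exact (summable_exp_majorant _ _).of_norm_bounded fun k =>
    abs_evenSeries_term_le hM hA (h k) le_rfl (hf k)

lemma abs_evenSeries_le {M A : ℝ} (hM : 0 ≤ M) (hA : 0 ≤ A) (hc : ∀ k, |c k| ≤ M * A ^ k)
    (hf : ∀ k, |f k| ≤ K * (L ^ k / k.factorial)) (ξ : ℝ) :
    |evenSeries c f ξ| ≤ M * K * Real.exp (A * ξ ^ 2 * L) := by
  have h := (NormedSpace.expSeries_div_hasSum_exp (𝔸 := ℝ) (A * |ξ| ^ 2 * L)).mul_left (M * K)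
  rw [← Real.exp_eq_exp_ℝ, sq_abs] at h
  refine tsum_of_norm_bounded (f := fun k => c k * (ξ ^ (2 * k) * f k)) h fun k => ?_
  have := abs_evenSeries_term_le hM hA (hc k) (le_refl |ξ|) (hf k)
  rwa [sq_abs] at this

lemma hasDerivAt_evenSeries (hc : GeomBounded c) (hf : ∀ k, |f k| ≤ K * (L ^ k / k.factorial))
    {ξ : ℝ} (hξ : ξ ≠ 0) :
    HasDerivAt (evenSeries c f) (ξ⁻¹ * evenSeries (fun k => 2 * k * c k) f ξ) ξ := by
  obtain ⟨M, A, hM, hA, h⟩ := hc.two_mul_nat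
  have key := hasDerivAt_tsum_of_isPreconnected (t := Metric.ball (0 : ℝ) (|ξ| + 1))
    (g := fun k η => c k * (η ^ (2 * k) * f k))
    (g' := fun k η => c k * (((2 * k : ℕ) * η ^ (2 * k - 1)) * f k)) (y₀ := ξ) (y := ξ)
    (summable_exp_majorant (M * K) (A * (|ξ| + 1) ^ 2 * L)) Metric.isOpen_ball
    (convex_ball _ _).isPreconnected
    (fun k η _ => ((hasDerivAt_pow (2 * k) η).mul_const _).const_mul _) (fun k η hη => ?_)
    (by simp) (summable_evenSeries hc hf ξ) (by simp)
  · refine key.congr_deriv ?_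
    rw [evenSeries, ← tsum_mul_left]
    refine tsum_congr fun k => ?_
    rcases k with _ | k
    · simp
    · rw [show 2 * (k + 1) - 1 = 2 * k + 1 by omega, show 2 * (k + 1) = 2 * k + 1 + 1 by ring,
        pow_succ ξ (2 * k + 1)]
      push_cast
      field_simp
      ring
  · have hη' : |η| ≤ |ξ| + 1 := by simpa using (mem_ball_zero_iff.1 hη).le
    have := abs_evenSeries_term_le (c := fun k => 2 * k * c k) hM hA (h k) (R := |ξ| + 1) (ξ := |ξ| + 1)
      (abs_of_nonneg (by positivity)).le (hf k)
    refine le_trans ?_ this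
    have hp : |η| ^ (2 * k - 1) ≤ (|ξ| + 1) ^ (2 * k) :=
      (pow_le_pow_left₀ (abs_nonneg _) hη' _).trans
        (pow_le_pow_right₀ (by linarith [abs_nonneg ξ]) (Nat.sub_le _ _))
    have e : |(|ξ| + 1) ^ (2 * k)| = (|ξ| + 1) ^ (2 * k) := abs_of_nonneg (by positivity)
    simp only [Real.norm_eq_abs, abs_mul, e, abs_pow, Nat.abs_cast, abs_two]
    push_cast
    calc |c k| * (2 * k * |η| ^ (2 * k - 1) * |f k|)
        ≤ |c k| * (2 * k * (|ξ| + 1) ^ (2 * k) * |f k|) := by gcongr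
      _ = _ := by ring

lemma hasDerivAt_evenSeries_param (hc : GeomBounded c) {f f' : ℕ → ℝ → ℝ} {K' : ℝ → ℝ} {x : ℝ}
    (hf : ∀ k, |f k x| ≤ K * (L ^ k / k.factorial)) (hd : ∀ k y, HasDerivAt (f k) (f' k y) y)
    (hf' : ∀ r k y, |y| ≤ r → |f' k y| ≤ K' r * ((r ^ 2) ^ k / k.factorial)) (ξ : ℝ) :
    HasDerivAt (fun y => evenSeries c (f · y) ξ) (evenSeries c (f' · x) ξ) x := by
  have hs := summable_evenSeries hc hf ξ
  obtain ⟨M, A, hM, hA, h⟩ := hc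
  refine hasDerivAt_tsum_of_isPreconnected (t := Metric.ball (0 : ℝ) (|x| + 1))
    (g := fun k y => c k * (ξ ^ (2 * k) * f k y)) (y₀ := x)
    (summable_exp_majorant (M * K' (|x| + 1)) (A * |ξ| ^ 2 * (|x| + 1) ^ 2)) Metric.isOpen_ball
    (convex_ball _ _).isPreconnected
    (fun k y _ => ((hd k y).const_mul _).const_mul _) (fun k y hy => ?_)
    (by simp) hs (by simp)
  exact abs_evenSeries_term_le hM hA (h k) le_rfl
    (hf' _ k y (by simpa using (mem_ball_zero_iff.1 hy).le))

end Series

section FundamentalSystem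

/-- The superposition `∑ c k * ξ ^ (2 * k) * volterraIter (k + 1) x`. -/
def volterraSeries (c : ℕ → ℝ) (x ξ : ℝ) : ℝ := evenSeries c (fun k => volterraIter (k + 1) x) ξ

/-- The derivative of `volterraSeries c` in the first variable. -/
def volterraSeriesDeriv (c : ℕ → ℝ) (x ξ : ℝ) : ℝ :=
  evenSeries c (fun k => volterraIterDeriv k x) ξ

variable {c : ℕ → ℝ}

lemma hasDerivAt_volterraSeries (hc : GeomBounded c) (x ξ : ℝ) :
    HasDerivAt (fun y => volterraSeries c y ξ) (volterraSeriesDeriv c x ξ) x := by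
  refine hasDerivAt_evenSeries_param hc (f := fun k => volterraIter (k + 1)) (K' := fun r => r)
    (abs_volterraIter_succ_le · x) hasDerivAt_volterraIter_succ (fun r k y hy => ?_) ξ
  have hy2 : y ^ 2 ≤ r ^ 2 := sq_le_sq' (abs_le.1 hy).1 (abs_le.1 hy).2
  have hr : 0 ≤ r := (abs_nonneg y).trans hy
  exact (abs_volterraIterDeriv_le k y).trans (by gcongr)

lemma hasDerivAt_volterraSeriesDeriv (hc : GeomBounded c) (x ξ : ℝ) :
    HasDerivAt (fun y => volterraSeriesDeriv c y ξ)
      (c 0 + ξ ^ 2 * volterraSeries (fun k => c (k + 1)) x ξ -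
        4 * x / (1 + x ^ 2) * volterraSeriesDeriv c x ξ) x := by
  have key := hasDerivAt_evenSeries_param hc (f := volterraIterDeriv) (K' := fun r => 1 + 2 * r)
    (abs_volterraIterDeriv_le · x) hasDerivAt_volterraIterDeriv (fun r k y hy => ?_) ξ
  · refine key.congr_deriv ?_
    have hs₀ := summable_evenSeries hc (f := (volterraIter · x)) (K := 1)
      (fun k => by simpa using abs_volterraIter_le k x) ξ
    have hs₁ := summable_evenSeries hc (abs_volterraIterDeriv_le · x) ξ
    have h₀ : ∑' k, c k * (ξ ^ (2 * k) * volterraIter k x) =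
        c 0 + ξ ^ 2 * volterraSeries (fun k => c (k + 1)) x ξ := by
      rw [hs₀.tsum_eq_zero_add, volterraSeries, evenSeries, ← tsum_mul_left]
      congr 1
      · simp [volterraIter]
      · refine tsum_congr fun k => ?_
        ring
    rw [← h₀, volterraSeriesDeriv, evenSeries, evenSeries, ← tsum_mul_left,
      ← hs₀.tsum_sub (hs₁.mul_left _)]
    refine tsum_congr fun k => ?_
    ring
  · have hy2 : y ^ 2 ≤ r ^ 2 := sq_le_sq' (abs_le.1 hy).1 (abs_le.1 hy).2
    have hr : 0 ≤ r := (abs_nonneg y).trans hy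
    have h₁ : |4 * y / (1 + y ^ 2)| ≤ 2 := by
      rw [abs_div, abs_of_pos (by positivity : 0 < 1 + y ^ 2), div_le_iff₀ (by positivity), abs_mul,
        abs_of_pos four_pos]
      nlinarith [sq_nonneg (|y| - 1), sq_abs y]
    have h₂ : |volterraIter k y| ≤ (r ^ 2) ^ k / k.factorial :=
      (abs_volterraIter_le k y).trans (by gcongr)
    have h₃ : |volterraIterDeriv k y| ≤ r * ((r ^ 2) ^ k / k.factorial) :=
      (abs_volterraIterDeriv_le k y).trans (by gcongr)
    calc |volterraIter k y - 4 * y / (1 + y ^ 2) * volterraIterDeriv k y|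
        ≤ |volterraIter k y| + |4 * y / (1 + y ^ 2)| * |volterraIterDeriv k y| := by
          rw [← abs_mul]; exact abs_sub _ _
      _ ≤ (r ^ 2) ^ k / k.factorial + 2 * (r * ((r ^ 2) ^ k / k.factorial)) := by gcongr
      _ = _ := by ring

lemma hasDerivAt_volterraSeries_snd (hc : GeomBounded c) (x : ℝ) {ξ : ℝ} (hξ : ξ ≠ 0) :
    HasDerivAt (volterraSeries c x) (ξ⁻¹ * volterraSeries (fun k => 2 * k * c k) x ξ) ξ :=
  hasDerivAt_evenSeries hc (abs_volterraIter_succ_le · x) hξ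

lemma hasDerivAt_volterraSeriesDeriv_snd (hc : GeomBounded c) (x : ℝ) {ξ : ℝ} (hξ : ξ ≠ 0) :
    HasDerivAt (volterraSeriesDeriv c x)
      (ξ⁻¹ * volterraSeriesDeriv (fun k => 2 * k * c k) x ξ) ξ :=
  hasDerivAt_evenSeries hc (abs_volterraIterDeriv_le · x) hξ

lemma sq_mul_sq_le_of_mem {p : ℝ × ℝ} (h : p ∈ symbolRegion) : p.2 ^ 2 * p.1 ^ 2 ≤ 1 / 4 := by
  obtain ⟨h0, h2, h3, h4⟩ := h
  have : -(1 / 2) < p.1 * p.2 := by nlinarith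
  nlinarith

lemma symbolBound_volterraSeries (hc : GeomBounded c) :
    SymbolBound 2 (volterraSeries c) ∧
      SymbolBound 2 (fun x ξ => jap x * volterraSeriesDeriv c x ξ) := by
  obtain ⟨M, A, hM, hA, h⟩ := hc
  have hexp {p : ℝ × ℝ} (hp : p ∈ symbolRegion) : A * p.2 ^ 2 * p.1 ^ 2 ≤ A := by
    nlinarith [sq_mul_sq_le_of_mem hp]
  refine ⟨⟨M * Real.exp A, fun p hp => ?_⟩, ⟨M * Real.exp A, fun p hp => ?_⟩⟩
  · have hx : p.1 ^ 2 ≤ jap p.1 ^ (2 : ℤ) := by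
      rw [zpow_ofNat, sq_jap]
      linarith
    calc |volterraSeries c p.1 p.2| ≤ M * p.1 ^ 2 * Real.exp (A * p.2 ^ 2 * p.1 ^ 2) :=
          abs_evenSeries_le hM hA h (abs_volterraIter_succ_le · p.1) p.2
      _ ≤ M * jap p.1 ^ (2 : ℤ) * Real.exp A := by gcongr; exact hexp hp
      _ = _ := by ring
  · have hj := jap_pos p.1
    calc |jap p.1 * volterraSeriesDeriv c p.1 p.2|
        = jap p.1 * |volterraSeriesDeriv c p.1 p.2| := by rw [abs_mul, abs_of_pos hj]
      _ ≤ jap p.1 * (M * |p.1| * Real.exp (A * p.2 ^ 2 * p.1 ^ 2)) := by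
          gcongr
          exact abs_evenSeries_le hM hA h (abs_volterraIterDeriv_le · p.1) p.2
      _ ≤ jap p.1 * (M * jap p.1 * Real.exp A) := by
          gcongr
          exacts [abs_le_jap _, hexp hp]
      _ = _ := by rw [zpow_ofNat]; ring

lemma isSymbol_volterraSeries_and_deriv (n : ℕ) (hc : GeomBounded c) :
    IsSymbol n 2 (volterraSeries c) ∧
      IsSymbol n 2 (fun x ξ => jap x * volterraSeriesDeriv c x ξ) := by
  induction n generalizing c with
  | zero => exact symbolBound_volterraSeries hc
  | succ n ih =>
    obtain ⟨hb₁, hb₂⟩ := symbolBound_volterraSeries hc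
    refine ⟨⟨hb₁, fun x ξ => jap x * volterraSeriesDeriv c x ξ,
      volterraSeries fun k => 2 * k * c k, fun p _ => ?_,
      fun p hp => hasDerivAt_volterraSeries_snd hc _ hp.1.ne', (ih hc).2, (ih hc.two_mul_nat).1⟩,
      ⟨hb₂, fun x ξ => jap x * jap x * c 0 + jap x * ξ * (jap x * ξ) *
          volterraSeries (fun k => c (k + 1)) x ξ -
          3 * ((jap x)⁻¹ * x * (jap x * volterraSeriesDeriv c x ξ)),
        fun x ξ => jap x * volterraSeriesDeriv (fun k => 2 * k * c k) x ξ, fun p _ => ?_,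
        fun p hp => ?_, ?_, (ih hc.two_mul_nat).2⟩⟩
    · exact (hasDerivAt_volterraSeries hc p.1 p.2).congr_deriv (by field_simp [jap_ne_zero p.1])
    · refine ((hasDerivAt_jap p.1).fun_mul
        (hasDerivAt_volterraSeriesDeriv hc p.1 p.2)).congr_deriv ?_
      have hj := jap_ne_zero p.1
      rw [← sq_jap]
      field_simp
      ring
    · exact ((hasDerivAt_volterraSeriesDeriv_snd hc p.1 hp.1.ne').const_mul (jap p.1)).congr_deriv
        (by ring)
    · have h₁ : IsSymbol n 2 fun x _ => jap x * jap x * c 0 := by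
        simpa using ((IsSymbol.jap_fst n).mul (IsSymbol.jap_fst n)).mul (IsSymbol.const n (c 0))
      have h₂ : IsSymbol n 0 fun x ξ => jap x * ξ := by
        simpa using (IsSymbol.jap_fst n).mul (IsSymbol.snd n)
      have h₃ : IsSymbol n 2 fun x ξ => jap x * ξ * (jap x * ξ) *
          volterraSeries (fun k => c (k + 1)) x ξ := by
        simpa using (h₂.mul h₂).mul (ih hc.shift).1
      have h₄ := ((IsSymbol.div_jap n).mul (ih hc).2).const_mul 3
      simpa [sub_eq_add_neg] using (h₁.add h₃).add (IsSymbol.neg (by simpa using h₄))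

lemma deriv_reduction_of_order {u u' I : ℝ → ℝ} {V x : ℝ} (hu : ∀ y, HasDerivAt u (u' y) y)
    (hu' : HasDerivAt u' (V * u x) x)
    (hI : ∀ᶠ y in 𝓝 x, u y ≠ 0 ∧ HasDerivAt I (-((u y)⁻¹) ^ 2) y) :
    deriv (fun y => u y * I y) x = u' x * I x - (u x)⁻¹ ∧
      deriv (deriv fun y => u y * I y) x = V * (u x * I x) := by
  have hd : deriv (fun y => u y * I y) =ᶠ[𝓝 x] fun y => u' y * I y - (u y)⁻¹ := by
    filter_upwards [hI] with y ⟨hy, hIy⟩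
    refine (((hu y).fun_mul hIy).congr_deriv ?_).deriv
    field_simp
    ring
  obtain ⟨hx, hIx⟩ := hI.self_of_nhds
  refine ⟨hd.self_of_nhds, ?_⟩
  rw [hd.deriv_eq]
  refine (((hu'.fun_mul hIx).fun_sub ((hu x).fun_inv hx)).congr_deriv ?_).deriv
  field_simp
  ring

/-- The correction `τ` in `φ₁ = (1 + x²) (1 + ξ² τ)`. -/
def solutionCorrection : ℝ → ℝ → ℝ := volterraSeries fun k => (-1) ^ (k + 1)

/-- The solution growing like `1 + x²`. -/
def growingSolution (x ξ : ℝ) : ℝ := (1 + x ^ 2) * (1 + ξ ^ 2 * solutionCorrection x ξ)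

/-- The derivative of `growingSolution` in the first variable. -/
def growingSolutionDeriv (x ξ : ℝ) : ℝ :=
  2 * x * (1 + ξ ^ 2 * solutionCorrection x ξ) +
    (1 + x ^ 2) * (ξ ^ 2 * volterraSeriesDeriv (fun k => (-1) ^ (k + 1)) x ξ)

/-- The solution decaying like `⟨x⟩⁻¹`. -/
def decayingSolution (x ξ : ℝ) : ℝ :=
  growingSolution x ξ * ∫ y in x..(1 / 4 / ξ), ((growingSolution y ξ)⁻¹) ^ 2

lemma geomBounded_neg_one_pow : GeomBounded fun k => (-1) ^ (k + 1) :=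
  ⟨1, 1, zero_le_one, zero_le_one, fun k => by simp⟩

lemma hasDerivAt_growingSolution (x ξ : ℝ) :
    HasDerivAt (fun y => growingSolution y ξ) (growingSolutionDeriv x ξ) x := by
  have h₁ : HasDerivAt (fun y : ℝ => 1 + y ^ 2) (2 * x) x := by
    simpa using (hasDerivAt_pow 2 x).const_add 1
  exact h₁.fun_mul
    (((hasDerivAt_volterraSeries geomBounded_neg_one_pow x ξ).const_mul (ξ ^ 2)).const_add 1)

lemma hasDerivAt_growingSolutionDeriv (x ξ : ℝ) :
    HasDerivAt (fun y => growingSolutionDeriv y ξ)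
      ((2 / (1 + x ^ 2) - ξ ^ 2) * growingSolution x ξ) x := by
  have h₁ : HasDerivAt (fun y : ℝ => 1 + y ^ 2) (2 * x) x := by
    simpa using (hasDerivAt_pow 2 x).const_add 1
  have h₂ : HasDerivAt (fun y : ℝ => 2 * y) 2 x := by
    simpa using (hasDerivAt_id' x).const_mul (2 : ℝ)
  have hs : volterraSeries (fun k => (-1) ^ (k + 1 + 1)) x ξ = -solutionCorrection x ξ := by
    rw [solutionCorrection, volterraSeries, volterraSeries, evenSeries, evenSeries, ← tsum_neg]
    exact tsum_congr fun k => by ring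
  have hτ := ((hasDerivAt_volterraSeries geomBounded_neg_one_pow x ξ).const_mul
    (ξ ^ 2)).const_add 1
  have hτ' := (hasDerivAt_volterraSeriesDeriv geomBounded_neg_one_pow x ξ).const_mul (ξ ^ 2)
  refine ((h₂.fun_mul hτ).fun_add (h₁.fun_mul hτ')).congr_deriv ?_
  have : 1 + x ^ 2 ≠ 0 := by positivity
  rw [hs, growingSolution, ← solutionCorrection]
  field_simp
  ring

lemma isSymbol_solutionCorrection (n : ℕ) : IsSymbol n 2 solutionCorrection :=
  (isSymbol_volterraSeries_and_deriv n geomBounded_neg_one_pow).1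

lemma isSymbol_one_add_correction (n : ℕ) :
    IsSymbol n 0 fun x ξ => 1 + ξ ^ 2 * solutionCorrection x ξ := by
  have := ((IsSymbol.snd n).mul (IsSymbol.snd n)).mul (isSymbol_solutionCorrection n)
  refine (IsSymbol.const n 1).add (IsSymbol.congr (by simpa using this) fun p _ => ?_)
  ring

lemma le_one_add_correction {p : ℝ × ℝ} (hp : p ∈ symbolRegion) :
    1 / 4 ≤ 1 + p.2 ^ 2 * solutionCorrection p.1 p.2 := by
  have h₁ : |solutionCorrection p.1 p.2| ≤ 1 * p.1 ^ 2 * Real.exp (1 * p.2 ^ 2 * p.1 ^ 2) :=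
    abs_evenSeries_le (M := 1) (A := 1) zero_le_one zero_le_one (fun k => by simp)
      (abs_volterraIter_succ_le · p.1) p.2
  have hsq := sq_mul_sq_le_of_mem hp
  have h₂ : Real.exp (1 * p.2 ^ 2 * p.1 ^ 2) ≤ 3 :=
    (Real.exp_le_exp.2 (by linarith)).trans Real.exp_one_lt_three.le
  have h₃ : p.2 ^ 2 * |solutionCorrection p.1 p.2| ≤ 1 / 4 * 3 :=
    calc p.2 ^ 2 * |solutionCorrection p.1 p.2|
        ≤ p.2 ^ 2 * (1 * p.1 ^ 2 * 3) := by
          gcongr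
          exact h₁.trans (by gcongr)
      _ ≤ 1 / 4 * 3 := by linarith
  nlinarith [neg_abs_le (solutionCorrection p.1 p.2), sq_nonneg p.2]

lemma growingSolution_ne_zero {p : ℝ × ℝ} (hp : p ∈ symbolRegion) :
    growingSolution p.1 p.2 ≠ 0 :=
  mul_ne_zero (by positivity) (by linarith [le_one_add_correction hp])

lemma isSymbol_growingSolution (n : ℕ) : IsSymbol n 2 growingSolution := by
  have := ((IsSymbol.jap_fst n).mul (IsSymbol.jap_fst n)).mul (isSymbol_one_add_correction n)
  refine IsSymbol.congr (by simpa using this) fun p _ => ?_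
  rw [growingSolution, ← sq_jap, sq]

lemma isSymbol_inv_growingSolution_sq (n : ℕ) :
    IsSymbol n (-4) fun x ξ => ((growingSolution x ξ)⁻¹) ^ 2 := by
  have hi := (((IsSymbol.inv_jap n).mul (IsSymbol.inv_jap n)).mul
    ((isSymbol_one_add_correction n).inv (c := 1 / 4) (by norm_num)
      fun p hp => le_one_add_correction hp))
  refine IsSymbol.congr (by simpa using hi.mul hi) fun p _ => ?_
  rw [growingSolution, ← sq_jap]
  simp only [mul_inv, sq]

lemma isSymbol_decayingSolution (n : ℕ) : IsSymbol n (-1) decayingSolution :=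
  (isSymbol_growingSolution n).mul (isSymbol_inv_growingSolution_sq (n + 1)).integral_endpoint

lemma deriv_decayingSolution {p : ℝ × ℝ} (hp : p ∈ symbolRegion) :
    deriv (fun y => decayingSolution y p.2) p.1 = growingSolutionDeriv p.1 p.2 *
        (∫ y in p.1..(1 / 4 / p.2), ((growingSolution y p.2)⁻¹) ^ 2) -
        (growingSolution p.1 p.2)⁻¹ ∧
      deriv (deriv fun y => decayingSolution y p.2) p.1 =
        (2 / (1 + p.1 ^ 2) - p.2 ^ 2) * decayingSolution p.1 p.2 := by
  refine deriv_reduction_of_order (u := fun y => growingSolution y p.2)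
    (hasDerivAt_growingSolution · p.2) (hasDerivAt_growingSolutionDeriv p.1 p.2) ?_
  filter_upwards [eventually_mk_left_mem hp] with y hy
  exact ⟨growingSolution_ne_zero hy, (isSymbol_inv_growingSolution_sq 1).hasDerivAt_integral_left hy⟩

end FundamentalSystem

/-- the fundamental system `{φ₁, φ₂}` of `-φ'' + 2/(1+x²) φ = ξ² φ`
on `[0, δ/ξ]`, with unit Wronskian and symbol-type bounds. -/
theorem fundamental_system_small_xi :
    ∃ δ : ℝ, 0 < δ ∧
    ∃ C : ℕ → ℕ → ℝ, (∀ a b : ℕ, 0 < C a b) ∧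
    ∃ τ φ₁ φ₂ : ℝ → ℝ → ℝ,
      ContDiffOn ℝ (⊤ : ℕ∞) (fun p : ℝ × ℝ => τ p.1 p.2)
        {p : ℝ × ℝ | 0 < p.2 ∧ p.2 ≤ 1 ∧ 0 ≤ p.1 ∧ p.1 ≤ δ / p.2} ∧
      (∀ ξ : ℝ, 0 < ξ → ξ ≤ 1 → ∀ x : ℝ, 0 ≤ x → x ≤ δ / ξ →
        (φ₁ x ξ = (1 + x ^ 2) * (1 + ξ ^ 2 * τ x ξ)) ∧
        (φ₂ x ξ = φ₁ x ξ * ∫ y in x..(δ / ξ), ((φ₁ y ξ)⁻¹) ^ 2) ∧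
        (- deriv (deriv (fun y : ℝ => φ₁ y ξ)) x + (2 / (1 + x ^ 2)) * φ₁ x ξ
            = ξ ^ 2 * φ₁ x ξ) ∧
        (- deriv (deriv (fun y : ℝ => φ₂ y ξ)) x + (2 / (1 + x ^ 2)) * φ₂ x ξ
            = ξ ^ 2 * φ₂ x ξ) ∧
        (deriv (fun y : ℝ => φ₁ y ξ) x * φ₂ x ξ
            - φ₁ x ξ * deriv (fun y : ℝ => φ₂ y ξ) x = 1) ∧
        (∀ a b : ℕ,
          |(DXR^[a] (DXIR^[b] τ)) x ξ| ≤ C a b * (jap x) ^ 2 ∧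
          |(DXR^[a] (DXIR^[b] φ₂)) x ξ| ≤ C a b * (jap x)⁻¹)) := by
  have hmem {x ξ : ℝ} (h0 : 0 < ξ) (h1 : ξ ≤ 1) (hx0 : 0 ≤ x) (hx : x ≤ 1 / 4 / ξ) :
      (x, ξ) ∈ symbolRegion := by
    refine ⟨h0, by simp only; linarith, by simp only; linarith, ?_⟩
    rw [le_div_iff₀ h0] at hx
    simp only
    linarith
  choose C₁ hC₁ hC₁' using fun a b : ℕ =>
    ((isSymbol_solutionCorrection (a + b)).iterate_DXR_DXIR a b).exists_pos
  choose C₂ hC₂ hC₂' using fun a b : ℕ =>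
    ((isSymbol_decayingSolution (a + b)).iterate_DXR_DXIR a b).exists_pos
  refine ⟨1 / 4, by norm_num, fun a b => max (C₁ a b) (C₂ a b),
    fun a b => lt_max_of_lt_left (hC₁ a b), solutionCorrection, growingSolution, decayingSolution,
    ContDiffOn.mono (s := symbolRegion) ?_ fun p hp => hmem hp.1 hp.2.1 hp.2.2.1 hp.2.2.2,
    fun ξ h0 h1 x hx0 hx => ?_⟩
  · exact contDiffOn_infty.2 fun n => (isSymbol_solutionCorrection (n + 1)).contDiffOn
  have hp := hmem h0 h1 hx0 hx
  have hd₁ : deriv (fun y => growingSolution y ξ) = fun y => growingSolutionDeriv y ξ :=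
    funext fun y => (hasDerivAt_growingSolution y ξ).deriv
  obtain ⟨hd₂, hdd₂⟩ := deriv_decayingSolution hp
  refine ⟨rfl, rfl, ?_, ?_, ?_, fun a b => ⟨?_, ?_⟩⟩
  · rw [hd₁, (hasDerivAt_growingSolutionDeriv x ξ).deriv]
    ring
  · rw [hdd₂]
    ring
  · rw [hd₁, hd₂, decayingSolution]
    have := growingSolution_ne_zero hp
    field_simp
    ring
  · refine (hC₁' a b _ hp).trans ?_
    rw [zpow_ofNat]
    gcongr
    exact le_max_left _ _
  · refine (hC₂' a b _ hp).trans ?_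
    have := jap_pos x
    rw [zpow_neg_one]
    gcongr
    exact le_max_right _ _
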